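/- The RANKING algorithm for online bipartite matching is (1 − 1/e)-competitive in expectation: if G is a bipartite graph with a maximum matching of size n, online vertices arrive in an arbitrary fixed order, and offline vertices are ranked by a uniformly random permutation, with each arriving vertex matched to its highest-ranked unmatched neighbour (if any), then the expected size of the produced matching is at least (1 − 1/e)·n. -/

import Mathlib

open Finset

def IsGraph {V : Type*} (G : Finset (Finset V)) : Prop := ∀ e ∈ G, e.card = 2

def IsMatching {V : Type*} (M : Finset (Finset V)) : Prop :=
  ∀ e ∈ M, ∀ f ∈ M, e ≠ f → Disjoint e f

/-- One step of RANKING: the arriving online vertex `u` is matched to the first (i.e.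
highest-ranked w.r.t. the ranking list `σ`) unmatched offline neighbour, if any. -/
def rankingStep {V : Type*} [DecidableEq V]
    (G : Finset (Finset V)) (σ : List V) (M : Finset (Finset V)) (u : V) :
    Finset (Finset V) :=
  match σ.find? (fun v => decide (({u, v} : Finset V) ∈ G ∧ ∀ e ∈ M, v ∉ e)) with
  | some v => insert ({u, v} : Finset V) M
  | none => M

/-- RANKING with ranking list `σ` of the offline side and arrival order `ω`. -/
def ranking {V : Type*} [DecidableEq V]
    (G : Finset (Finset V)) (σ : List V) (ω : List V) : Finset (Finset V) :=
  ω.foldl (fun M u => rankingStep G σ M u) ∅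

theorem asc_succ_left (n k : ℕ) :
    n.ascFactorial (k + 1) = n * (n + 1).ascFactorial k := by
  induction k with
  | zero => simp [Nat.ascFactorial]
  | succ k ih =>
    rw [Nat.ascFactorial_succ, ih, Nat.ascFactorial_succ (n := n + 1)]
    ring

theorem asc_mono {n n' : ℕ} (h : n ≤ n') (k : ℕ) : n.ascFactorial k ≤ n'.ascFactorial k := by
  induction k with
  | zero => simp
  | succ k ih =>
    rw [Nat.ascFactorial_succ, Nat.ascFactorial_succ]
    exact Nat.mul_le_mul (by omega) ih

/-- Numerical dual weights. -/
theorem exists_weights (m : ℕ) : ∃ a : ℕ → ℝ,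
    (∀ i j, i ≤ j → j ≤ m → a i ≤ a j) ∧ (∀ i, 0 ≤ a i) ∧ a m = 1 ∧
    ∀ p, p + 1 ≤ m → ((p + 1 : ℕ) : ℝ) * a (p + 1) + ((m : ℝ) - ((p + 1 : ℕ) : ℝ)) * a p
      = m * (Real.exp 1)⁻¹ + ∑ k ∈ Finset.range (p + 1), a k := by
  let t : ℕ → ℕ → ℝ := fun i j =>
    ((i + 1).ascFactorial j : ℝ) / (((m + 1).ascFactorial j : ℝ) * (j.factorial : ℝ))
  have hpos : ∀ j, (0 : ℝ) < ((m + 1).ascFactorial j : ℝ) := fun j => by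
    exact_mod_cast Nat.ascFactorial_pos m j
  have hfpos : ∀ j : ℕ, (0 : ℝ) < (j.factorial : ℝ) := fun j => by
    exact_mod_cast Nat.factorial_pos j
  have t0 : ∀ i j, 0 ≤ t i j := fun i j => by
    have := hpos j; have := hfpos j
    simp only [t]; positivity
  have tmono : ∀ i i' j, i ≤ i' → t i j ≤ t i' j := fun i i' j h => by
    have := hpos j; have := hfpos j
    have h2 : ((i + 1).ascFactorial j : ℝ) ≤ ((i' + 1).ascFactorial j : ℝ) := by
      exact_mod_cast asc_mono (show i + 1 ≤ i' + 1 by omega) j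
    simp only [t]; gcongr
  have tm : ∀ j, t m j = 1 ^ j / (j.factorial : ℝ) := fun j => by
    have := hpos j; have := hfpos j
    simp only [t]; field_simp; simp
  have hsm : HasSum (t m) (Real.exp 1) := by
    have h := NormedSpace.expSeries_div_hasSum_exp (1 : ℝ)
    rw [← Real.exp_eq_exp_ℝ] at h
    exact (funext tm : t m = _) ▸ h
  have hs : ∀ i, i ≤ m → Summable (t i) := fun i hi =>
    Summable.of_nonneg_of_le (t0 i) (fun j => tmono i m j hi) hsm.summable
  have hhock : ∀ p j, ∑ k ∈ Finset.range (p + 1), ((k + 1).ascFactorial j : ℝ) * (j + 1)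
      = (p + 1).ascFactorial (j + 1) := by
    intro p j
    induction p with
    | zero => simp [Nat.one_ascFactorial, Nat.factorial_succ]; ring
    | succ p ih =>
      rw [Finset.sum_range_succ, ih]
      have h1 : (p + 1).ascFactorial (j + 1) = (p + 1) * (p + 1 + 1).ascFactorial j :=
        asc_succ_left _ _
      have h2 : (p + 1 + 1).ascFactorial (j + 1) = (p + 1 + 1 + j) * (p + 1 + 1).ascFactorial j :=
        Nat.ascFactorial_succ
      rw [h1, h2]; push_cast; ring
  have hkey : ∀ p j, ((p + 1 : ℕ) : ℝ) * t (p + 1) (j + 1)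
      + ((m : ℝ) - ((p + 1 : ℕ) : ℝ)) * t p (j + 1) = ∑ k ∈ Finset.range (p + 1), t k j := by
    intro p j
    have e1 : ∑ k ∈ Finset.range (p + 1), t k j = ((p + 1).ascFactorial (j + 1) : ℝ) /
        ((j + 1) * ((m + 1).ascFactorial j * j.factorial)) := by
      rw [← hhock, Finset.sum_div]
      apply Finset.sum_congr rfl
      intro k _
      have := hpos j; have := hfpos j
      simp only [t]; field_simp
    rw [e1]
    have h1 : ((p + 1).ascFactorial (j + 1 + 1) : ℝ)
        = (p + 1) * ((p + 1 + 1).ascFactorial (j + 1) : ℝ) := by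
      exact_mod_cast (asc_succ_left _ _ : (p+1).ascFactorial (j + 1 + 1) = _)
    have h2 : ((p + 1).ascFactorial (j + 1 + 1) : ℝ)
        = (p + 1 + (j + 1)) * ((p + 1).ascFactorial (j + 1) : ℝ) := by
      exact_mod_cast (Nat.ascFactorial_succ : (p+1).ascFactorial (j + 1 + 1) = _)
    have h3 : ((m + 1).ascFactorial (j + 1) : ℝ)
        = (m + 1 + j) * ((m + 1).ascFactorial j : ℝ) := by
      exact_mod_cast (Nat.ascFactorial_succ : (m+1).ascFactorial (j + 1) = _)
    have h4 : ((j + 1).factorial : ℝ) = (j + 1) * j.factorial := by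
      exact_mod_cast Nat.factorial_succ j
    have := hpos j; have := hfpos j
    simp only [t]
    rw [h3, h4]
    have : (m + 1 + j : ℝ) ≠ 0 := by positivity
    have : (j + 1 : ℝ) ≠ 0 := by positivity
    field_simp
    push_cast
    linarith
  refine ⟨fun i => (Real.exp 1)⁻¹ * ∑' j, t i j, ?_, ?_, ?_, ?_⟩
  · intro i j hij hj
    have := (hs i (hij.trans hj)).tsum_le_tsum (fun k => tmono i j k hij) (hs j hj)
    have := Real.exp_pos 1
    show (Real.exp 1)⁻¹ * _ ≤ (Real.exp 1)⁻¹ * _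
    gcongr
  · intro i
    have : 0 ≤ ∑' j, t i j := tsum_nonneg (t0 i)
    have := Real.exp_pos 1
    positivity
  · show (Real.exp 1)⁻¹ * _ = _
    rw [hsm.tsum_eq]; exact inv_mul_cancel₀ (Real.exp_pos 1).ne'
  · intro p hp
    have s1 := hs (p + 1) hp
    have s0 := hs p (by omega)
    have z : ∀ i, t i 0 = 1 := fun i => by simp [t]
    have e1 := s1.tsum_eq_zero_add
    have e0 := s0.tsum_eq_zero_add
    rw [z] at e1 e0
    have s1' := (summable_nat_add_iff 1).2 s1
    have s0' := (summable_nat_add_iff 1).2 s0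
    have hk : ((p + 1 : ℕ) : ℝ) * ∑' j, t (p + 1) (j + 1)
      + ((m : ℝ) - ((p + 1 : ℕ) : ℝ)) * ∑' j, t p (j + 1)
      = ∑ k ∈ Finset.range (p + 1), ∑' j, t k j := by
      rw [← tsum_mul_left, ← tsum_mul_left, ← (s1'.mul_left _).tsum_add (s0'.mul_left _),
        ← Summable.tsum_finsetSum]
      · exact tsum_congr (hkey p)
      · intro k hk
        exact hs k (by have := Finset.mem_range.1 hk; omega)
    show _ * ((Real.exp 1)⁻¹ * ∑' j, t (p + 1) j) + _ * ((Real.exp 1)⁻¹ * ∑' j, t p j) = 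
      _ + ∑ k ∈ _, (Real.exp 1)⁻¹ * ∑' j, t k j
    rw [← Finset.mul_sum, ← hk, e1, e0]
    ring

section RankingAux
variable {V : Type*} [DecidableEq V]

/-- vertex picked by `u` when `A` is the set of matched offline vertices -/
def pick (G : Finset (Finset V)) (σ : List V) (A : Finset V) (u : V) : Option V :=
  σ.find? (fun v => decide (({u, v} : Finset V) ∈ G ∧ v ∉ A))

/-- one step on matched offline sets -/
def stepA (G : Finset (Finset V)) (σ : List V) (A : Finset V) (u : V) : Finset V :=
  match pick G σ A u with
  | some v => insert v A
  | none => A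

/-- the run on matched offline sets -/
def runA (G : Finset (Finset V)) (σ : List V) (A : Finset V) (ω : List V) : Finset V :=
  ω.foldl (stepA G σ) A

theorem find_min (p : V → Bool) (l : List V) (b : V) (h : l.find? p = some b) :
    ∀ x ∈ l, p x → l.idxOf b ≤ l.idxOf x := by
  induction l with
  | nil => simp at h
  | cons y ys ih =>
    intro x hx hpx
    by_cases hy : p y
    · rw [List.find?_cons_of_pos hy] at h
      cases h; simp
    · rw [List.find?_cons_of_neg hy] at h
      have hxy : x ≠ y := fun e => hy (e ▸ hpx)
      have hb : p b := List.find?_some h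
      have hby : b ≠ y := fun e => hy (e ▸ hb)
      rw [List.idxOf_cons_ne _ hxy.symm, List.idxOf_cons_ne _ hby.symm]
      have := ih h x (by simpa [hxy] using hx) hpx
      omega

theorem pick_some {G : Finset (Finset V)} {σ : List V} {A : Finset V} {u s : V}
    (h : pick G σ A u = some s) : s ∈ σ ∧ ({u, s} : Finset V) ∈ G ∧ s ∉ A ∧
      ∀ x ∈ σ, ({u, x} : Finset V) ∈ G → x ∉ A → σ.idxOf s ≤ σ.idxOf x := by
  have h1 := List.find?_some h
  have h2 := List.mem_of_find?_eq_some h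
  simp only [decide_eq_true_eq] at h1
  refine ⟨h2, h1.1, h1.2, fun x hx hg hA => find_min _ _ _ h x hx (by simp [hg, hA])⟩

theorem pick_exists {G : Finset (Finset V)} {σ : List V} {A : Finset V} {u x : V}
    (hx : x ∈ σ) (hg : ({u, x} : Finset V) ∈ G) (hA : x ∉ A) :
    ∃ s, pick G σ A u = some s := by
  cases h : pick G σ A u with
  | some s => exact ⟨s, rfl⟩
  | none =>
    have := List.find?_eq_none.1 h x hx
    simp [hg, hA] at this

theorem pick_none {G : Finset (Finset V)} {σ : List V} {A : Finset V} {u x : V}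
    (h : pick G σ A u = none) (hx : x ∈ σ) (hg : ({u, x} : Finset V) ∈ G) : x ∈ A := by
  by_contra hA
  obtain ⟨s, hs⟩ := pick_exists hx hg hA
  simp [h] at hs

/-- the pick is unchanged when the matched set grows but avoids the pick -/
theorem pick_mono {G : Finset (Finset V)} {σ : List V} {A B : Finset V} {u s : V}
    (hAB : A ⊆ B) (h : pick G σ A u = some s) (hs : s ∉ B) : pick G σ B u = some s := by
  obtain ⟨h1, h2, h3, h4⟩ := pick_some h
  obtain ⟨t, ht⟩ := pick_exists h1 h2 hs
  obtain ⟨k1, k2, k3, k4⟩ := pick_some ht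
  have := k4 s h1 h2 hs
  have := h4 t k1 k2 (fun e => k3 (hAB e))
  have : σ.idxOf t = σ.idxOf s := by omega
  rw [ht, (List.idxOf_inj k1).1 this]

theorem subset_stepA (G : Finset (Finset V)) (σ : List V) (A : Finset V) (u : V) :
    A ⊆ stepA G σ A u := by
  unfold stepA
  cases pick G σ A u with
  | some s => exact Finset.subset_insert _ _
  | none => exact subset_rfl

theorem subset_runA (G : Finset (Finset V)) (σ : List V) (ω : List V) (A : Finset V) :
    A ⊆ runA G σ A ω := by
  induction ω generalizing A with
  | nil => exact subset_rfl
  | cons u us ih => exact (subset_stepA G σ A u).trans (ih _)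

theorem stepA_mono (G : Finset (Finset V)) (σ : List V) {A B : Finset V} (h : A ⊆ B) (u : V) :
    stepA G σ A u ⊆ stepA G σ B u := by
  cases hp : pick G σ A u with
  | none => 
    have : stepA G σ A u = A := by simp [stepA, hp]
    rw [this]; exact h.trans (subset_stepA _ _ _ _)
  | some s =>
    have : stepA G σ A u = insert s A := by simp [stepA, hp]
    rw [this]
    refine Finset.insert_subset ?_ (h.trans (subset_stepA _ _ _ _))
    by_cases hs : s ∈ B
    · exact subset_stepA _ _ _ _ hs
    · have := pick_mono h hp hs
      simp [stepA, this]

theorem runA_mono (G : Finset (Finset V)) (σ : List V) (ω : List V) {A B : Finset V}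
    (h : A ⊆ B) : runA G σ A ω ⊆ runA G σ B ω := by
  induction ω generalizing A B with
  | nil => exact h
  | cons u us ih => exact ih (stepA_mono G σ h u)

theorem pick_remove (G : Finset (Finset V)) (τ₁ τ₂ : List V) (v : V) (hv : v ∉ τ₁ ++ τ₂)
    (A : Finset V) (u : V) :
    pick G (τ₁ ++ v :: τ₂) (insert v A) u = pick G (τ₁ ++ τ₂) A u := by
  have key : ∀ l : List V, v ∉ l → pick G l (insert v A) u = pick G l A u := by
    intro l hl
    unfold pick
    induction l with
    | nil => rfl
    | cons x xs ih =>
      have hx : x ≠ v := fun e => hl (by simp [e])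
      have := ih (fun e => hl (by simp [e]))
      simp only [List.find?_cons, this]
      simp [hx]
  rw [← key _ hv]
  unfold pick
  rw [List.find?_append, List.find?_append, List.find?_cons_of_neg]
  simp

theorem runA_remove (G : Finset (Finset V)) (τ₁ τ₂ : List V) (v : V) (hv : v ∉ τ₁ ++ τ₂)
    (ω : List V) (A : Finset V) :
    runA G (τ₁ ++ v :: τ₂) (insert v A) ω = insert v (runA G (τ₁ ++ τ₂) A ω) := by
  induction ω generalizing A with
  | nil => rfl
  | cons u us ih =>
    have : stepA G (τ₁ ++ v :: τ₂) (insert v A) u = insert v (stepA G (τ₁ ++ τ₂) A u) := by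
      unfold stepA
      rw [pick_remove G τ₁ τ₂ v hv]
      cases pick G (τ₁ ++ τ₂) A u with
      | none => rfl
      | some s => exact Finset.insert_comm _ _ _
    show runA G _ (stepA G _ _ u) us = insert v (runA G _ (stepA G _ _ u) us)
    rw [this, ih]

theorem pick_never (G : Finset (Finset V)) (σ : List V) (v : V) (A : Finset V) (u : V)
    (hv : v ∉ stepA G σ A u) : pick G σ (insert v A) u = pick G σ A u := by
  cases hp : pick G σ A u with
  | some s =>
    apply pick_mono (Finset.subset_insert _ _) hp
    have h1 : s ≠ v := by rintro rfl; simp [stepA, hp] at hv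
    simp [h1, (pick_some hp).2.2.1]
  | none =>
    cases hq : pick G σ (insert v A) u with
    | none => rfl
    | some s =>
      obtain ⟨h1, h2, h3, -⟩ := pick_some hq
      exact absurd (Finset.mem_insert_of_mem (pick_none hp h1 h2)) h3

theorem runA_never (G : Finset (Finset V)) (σ : List V) (v : V) (ω : List V) (A : Finset V)
    (hv : v ∉ runA G σ A ω) : runA G σ (insert v A) ω = insert v (runA G σ A ω) := by
  induction ω generalizing A with
  | nil => rfl
  | cons u us ih =>
    have h1 : v ∉ stepA G σ A u := fun h => hv (subset_runA G σ us _ h)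
    have : stepA G σ (insert v A) u = insert v (stepA G σ A u) := by
      unfold stepA
      rw [pick_never G σ v A u h1]
      cases pick G σ A u with
      | none => rfl
      | some s => exact Finset.insert_comm _ _ _
    show runA G _ (stepA G _ _ u) us = insert v (runA G _ (stepA G _ _ u) us)
    rw [this, ih _ hv]

/-- relation with the actual matching -/
theorem ranking_card (G : Finset (Finset V)) (L R : Finset V) (hLR : Disjoint L R)
    (σ : List V) (hσ : ∀ x ∈ σ, x ∈ L) (ω : List V) (hω : ∀ x ∈ ω, x ∈ R)
    (M : Finset (Finset V)) (A : Finset V)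
    (hMA : ∀ v ∈ L, v ∉ A ↔ ∀ e ∈ M, v ∉ e) (hc : M.card = A.card) :
    (ω.foldl (fun M u => rankingStep G σ M u) M).card = (runA G σ A ω).card := by
  induction ω generalizing M A with
  | nil => exact hc
  | cons u us ih =>
    have huR : u ∈ R := hω u (by simp)
    have hp : σ.find? (fun v => decide (({u, v} : Finset V) ∈ G ∧ ∀ e ∈ M, v ∉ e))
        = pick G σ A u := by
      unfold pick
      clear ih
      induction σ with
      | nil => rfl
      | cons x xs ih2 =>
        have := ih2 (fun y hy => hσ y (by simp [hy]))
        have h3 := hMA x (hσ x (by simp))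
        simp only [List.find?_cons, this, h3]
    show (us.foldl (fun M u => rankingStep G σ M u) (rankingStep G σ M u)).card =
      (runA G σ (stepA G σ A u) us).card
    unfold rankingStep stepA
    rw [hp]
    cases hq : pick G σ A u with
    | none => exact ih (fun x hx => hω x (by simp [hx])) _ _ hMA hc
    | some s =>
      obtain ⟨h1, h2, h3, -⟩ := pick_some hq
      have hsL := hσ s h1
      have hs := (hMA s hsL).1 h3
      apply ih (fun x hx => hω x (by simp [hx]))
      · intro v hv
        have hvu : v ≠ u := fun e => Finset.disjoint_left.1 hLR hv (e ▸ huR)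
        simp [hvu, hMA v hv]
      · rw [Finset.card_insert_of_notMem h3, Finset.card_insert_of_notMem, hc]
        intro hm
        exact hs _ hm (by simp)

/-- dual gain of an online vertex -/
noncomputable def gainU (G : Finset (Finset V)) (a : ℕ → ℝ) (σ : List V) (u : V) :
    Finset V → List V → ℝ
  | _, [] => 0
  | A, w :: ws => if w = u then
      (match pick G σ A u with
        | some s => 1 - a (σ.idxOf s)
        | none => 0)
      else gainU G a σ u (stepA G σ A w) ws

theorem gainU_split (G : Finset (Finset V)) (a : ℕ → ℝ) (σ : List V) (u : V)
    (pre post : List V) (hu : u ∉ pre) (A : Finset V) :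
    gainU G a σ u A (pre ++ u :: post) =
      (match pick G σ (runA G σ A pre) u with
        | some s => 1 - a (σ.idxOf s)
        | none => 0) := by
  induction pre generalizing A with
  | nil => simp [gainU, runA]
  | cons w ws ih =>
    have : w ≠ u := fun e => hu (by simp [e])
    simp only [List.cons_append, gainU, this, if_false]
    exact ih (fun h => hu (by simp [h])) _

theorem gainU_nonneg (G : Finset (Finset V)) (a : ℕ → ℝ) (σ : List V) (u : V)
    (ha : ∀ i < σ.length, a i ≤ 1) (ω : List V) (A : Finset V) :
    0 ≤ gainU G a σ u A ω := by
  induction ω generalizing A with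
  | nil => simp [gainU]
  | cons w ws ih =>
    unfold gainU
    split_ifs
    · cases h : pick G σ A u with
      | none => simp
      | some s =>
        have := ha _ (List.idxOf_lt_length_of_mem (pick_some h).1)
        simpa using this
    · exact ih _

theorem sum_gainU (G : Finset (Finset V)) (a : ℕ → ℝ) (σ : List V) (ω : List V) (hω : ω.Nodup)
    (A : Finset V) :
    ∑ u ∈ ω.toFinset, gainU G a σ u A ω + ∑ v ∈ A, (1 - a (σ.idxOf v))
      = ∑ v ∈ runA G σ A ω, (1 - a (σ.idxOf v)) := by
  induction ω generalizing A with
  | nil => simp [runA]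
  | cons w ws ih =>
    rw [List.nodup_cons] at hω
    show _ = ∑ v ∈ runA G σ (stepA G σ A w) ws, _
    rw [← ih hω.2, List.toFinset_cons, Finset.sum_insert (by simpa using hω.1)]
    have h1 : ∑ u ∈ ws.toFinset, gainU G a σ u A (w :: ws)
        = ∑ u ∈ ws.toFinset, gainU G a σ u (stepA G σ A w) ws := by
      apply Finset.sum_congr rfl
      intro u hu
      have : w ≠ u := by rintro rfl; exact hω.1 (by simpa using hu)
      simp [gainU, this]
    rw [h1]
    cases h : pick G σ A w with
    | none => simp [gainU, stepA, h]
    | some s =>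
      have := (pick_some h).2.2.1
      simp only [gainU, stepA, h, if_true]
      rw [Finset.sum_insert this]
      ring

/-- dual gain of an offline vertex -/
noncomputable def gainV (G : Finset (Finset V)) (a : ℕ → ℝ) (σ : List V) (ω : List V) (v : V) : ℝ :=
  if v ∈ runA G σ ∅ ω then a (σ.idxOf v) else 0

theorem runA_subset (G : Finset (Finset V)) (σ : List V) (ω : List V) (A : Finset V) :
    runA G σ A ω ⊆ A ∪ σ.toFinset := by
  induction ω generalizing A with
  | nil => exact Finset.subset_union_left
  | cons u us ih =>
    refine (ih (stepA G σ A u)).trans ?_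
    refine Finset.union_subset ?_ Finset.subset_union_right
    unfold stepA
    cases h : pick G σ A u with
    | none => exact Finset.subset_union_left
    | some s =>
      have := (pick_some h).1
      exact Finset.insert_subset (by simp [this]) Finset.subset_union_left

theorem sum_gain (G : Finset (Finset V)) (a : ℕ → ℝ) (σ : List V) (ω : List V) (hω : ω.Nodup) :
    ∑ u ∈ ω.toFinset, gainU G a σ u ∅ ω + ∑ v ∈ σ.toFinset, gainV G a σ ω v
      = (runA G σ ∅ ω).card := by
  have h := sum_gainU G a σ ω hω ∅
  have h2 : ∑ v ∈ σ.toFinset, gainV G a σ ω v = ∑ v ∈ runA G σ ∅ ω, a (σ.idxOf v) := by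
    unfold gainV
    rw [← Finset.sum_filter]
    congr 1
    have := runA_subset G σ ω ∅
    ext x
    simp only [Finset.mem_filter, and_iff_right_iff_imp]
    intro hx
    simpa using this hx
  rw [h2]
  simp only [Finset.sum_empty, add_zero] at h
  rw [h, ← Finset.sum_add_distrib]
  simp

/-- one insertion position: `p` is the position of the match of `u` without `v`. -/
theorem gain_one (G : Finset (Finset V)) (a : ℕ → ℝ) (τ₁ τ₂ : List V) (u v : V)
    (hv : v ∉ τ₁ ++ τ₂) (hG : ({u, v} : Finset V) ∈ G)
    (hmono : ∀ i j, i ≤ j → j ≤ (τ₁ ++ τ₂).length + 1 → a i ≤ a j) 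
    (pre post : List V) (hu : u ∉ pre) :
    (match pick G (τ₁ ++ τ₂) (runA G (τ₁ ++ τ₂) ∅ pre) u with
      | some y =>
        (τ₁.length ≤ (τ₁ ++ τ₂).idxOf y →
          gainV G a (τ₁ ++ v :: τ₂) (pre ++ u :: post) v = a τ₁.length ∧
          1 - a ((τ₁ ++ τ₂).idxOf y + 1) ≤ gainU G a (τ₁ ++ v :: τ₂) u ∅ (pre ++ u :: post)) ∧
        ((τ₁ ++ τ₂).idxOf y < τ₁.length →
          1 - a ((τ₁ ++ τ₂).idxOf y) ≤ gainU G a (τ₁ ++ v :: τ₂) u ∅ (pre ++ u :: post))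
      | none => gainV G a (τ₁ ++ v :: τ₂) (pre ++ u :: post) v = a τ₁.length) := by
  set τ := τ₁ ++ τ₂ with hτ
  set σ := τ₁ ++ v :: τ₂ with hσ
  set B := runA G τ ∅ pre with hB
  set A := runA G σ ∅ pre with hA
  have hv1 : v ∉ τ₁ := fun h => hv (by simp [hτ, h])
  have hvidx : σ.idxOf v = τ₁.length := by
    rw [hσ, List.idxOf_append_of_notMem hv1]; simp
  have hvσ : v ∈ σ := by simp [hσ]
  have hrem : runA G σ (insert v ∅) pre = insert v B := runA_remove G τ₁ τ₂ v hv pre ∅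
  have hAB : A ⊆ insert v B := by
    rw [← hrem]; exact runA_mono G σ pre (Finset.empty_subset _)
  have hpk : pick G σ (insert v B) u = pick G τ B u := pick_remove G τ₁ τ₂ v hv B u
  -- idx
  have idx1 : ∀ y ∈ τ, τ₁.length ≤ τ.idxOf y → σ.idxOf y = τ.idxOf y + 1 := by
    intro y hy hle
    have hy1 : y ∉ τ₁ := fun h => by
      have := List.idxOf_lt_length_of_mem h
      rw [hτ, List.idxOf_append_of_mem h] at hle; omega
    have hyv : v ≠ y := fun e => hv (e ▸ hy)
    rw [hτ, hσ, List.idxOf_append_of_notMem hy1, List.idxOf_append_of_notMem hy1,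
      List.idxOf_cons_ne _ hyv]
    omega
  have idx2 : ∀ y, τ.idxOf y < τ₁.length → σ.idxOf y = τ.idxOf y := by
    intro y hlt
    have hy1 : y ∈ τ₁ := by
      by_contra h
      rw [hτ, List.idxOf_append_of_notMem h] at hlt; omega
    rw [hτ, hσ, List.idxOf_append_of_mem hy1, List.idxOf_append_of_mem hy1]
  -- if v is never matched
  have hnever : v ∉ runA G σ ∅ (pre ++ u :: post) →
      ∃ s, pick G τ B u = some s ∧ σ.idxOf s ≤ τ₁.length := by
    intro hn
    have hrun : runA G σ ∅ (pre ++ u :: post) = runA G σ (stepA G σ A u) post := by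
      simp [runA, hA, List.foldl_append]
    rw [hrun] at hn
    have hn1 : v ∉ stepA G σ A u := fun h => hn (subset_runA _ _ _ _ h)
    have hn2 : v ∉ A := fun h => hn1 (subset_stepA _ _ _ _ h)
    have h1 := runA_never G σ v pre ∅ hn2
    rw [hrem] at h1
    obtain ⟨s, hs⟩ := pick_exists hvσ hG hn2
    refine ⟨s, ?_, ?_⟩
    · rw [← hpk, h1, pick_never G σ v _ u hn1, hs]
    · rw [← hvidx]; exact (pick_some hs).2.2.2 v hvσ hG hn2
  have hgu : ∀ y, pick G τ B u = some y → 
      1 - a (σ.idxOf y) ≤ gainU G a σ u ∅ (pre ++ u :: post) := by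
    intro y hy
    rw [gainU_split G a σ u pre post hu]
    rw [← hpk] at hy
    obtain ⟨h1, h2, h3, -⟩ := pick_some hy
    have hyA : y ∉ A := fun h => h3 (hAB h)
    obtain ⟨s, hs⟩ := pick_exists h1 h2 hyA
    have hle := (pick_some hs).2.2.2 y h1 h2 hyA
    have hlt := List.idxOf_lt_length_of_mem h1
    have hlen : σ.length = τ.length + 1 := by simp [hσ, hτ]; omega
    have := hmono _ _ hle (by omega)
    rw [← hA, hs]
    show 1 - a _ ≤ 1 - a _
    linarith
  cases hy : pick G τ B u with
  | none =>
    show gainV G a σ _ v = _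
    unfold gainV
    rw [if_pos, hvidx]
    by_contra hn
    obtain ⟨s, hs, -⟩ := hnever hn
    simp [hy] at hs
  | some y =>
    have hyτ := (pick_some hy).1
    refine ⟨fun hle => ⟨?_, ?_⟩, fun hlt => ?_⟩
    · unfold gainV
      rw [if_pos, hvidx]
      by_contra hn
      obtain ⟨s, hs, h⟩ := hnever hn
      rw [hy] at hs; cases hs
      rw [idx1 y hyτ hle] at h
      omega
    · rw [← idx1 y hyτ hle]; exact hgu y hy
    · rw [← idx2 y hlt]; exact hgu y hy

theorem perm'Aux_eq (v : V) (τ : List V) :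
    List.permutations'Aux v τ = (List.range (τ.length + 1)).map
      (fun k => τ.take k ++ v :: τ.drop k) := by
  induction τ with
  | nil => simp
  | cons y ys ih =>
    rw [List.permutations'Aux, ih, List.length_cons, List.range_succ_eq_map (n := ys.length + 1)]
    simp [Function.comp_def]

/-- sum over the insertion positions -/
theorem gain_sum (G : Finset (Finset V)) (a : ℕ → ℝ) (τ : List V) (u v : V) (m : ℕ)
    (hm : m = τ.length + 1)
    (hv : v ∉ τ) (hG : ({u, v} : Finset V) ∈ G)
    (hmono : ∀ i j, i ≤ j → j ≤ m → a i ≤ a j) (ha0 : ∀ i, 0 ≤ a i) (ham : a m = 1)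
    (hid : ∀ p, p + 1 ≤ m → ((p + 1 : ℕ) : ℝ) * a (p + 1) + ((m : ℝ) - ((p + 1 : ℕ) : ℝ)) * a p
      = m * (Real.exp 1)⁻¹ + ∑ k ∈ Finset.range (p + 1), a k)
    (ω : List V) (hω : ω.Nodup) (hu : u ∈ ω) :
    (m : ℝ) * (1 - (Real.exp 1)⁻¹) ≤
      ((List.permutations'Aux v τ).map (fun σ => gainV G a σ ω v + gainU G a σ u ∅ ω)).sum := by
  obtain ⟨pre, post, rfl⟩ := List.append_of_mem hu
  have hpre : u ∉ pre := by
    intro h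
    have := (List.nodup_append.1 hω).2.2 u h u (by simp)
    exact this rfl
  rw [perm'Aux_eq, List.map_map, ← hm]
  rw [← List.sum_toFinset _ (List.nodup_range), List.toFinset_range]
  simp only [Function.comp_apply]
  have hV0 : ∀ σ, 0 ≤ gainV G a σ (pre ++ u :: post) v := fun σ => by
    unfold gainV; split_ifs
    · exact ha0 _
    · exact le_rfl
  have one : ∀ k < m, _ := fun k (hk : k < m) =>
    gain_one G a (τ.take k) (τ.drop k) u v (by simpa using hv) hG
      (by simpa [hm] using hmono) pre post hpre
  simp only [List.take_append_drop] at one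
  have hU0 : ∀ k < m, 0 ≤ gainU G a (τ.take k ++ v :: τ.drop k) u ∅ (pre ++ u :: post) := by
    intro k hk
    apply gainU_nonneg
    intro i hi
    rw [← ham]
    apply hmono _ _ _ le_rfl
    simp at hi; omega
  have hlk : ∀ k < m, (τ.take k).length = k := fun k hk => by simp; omega
  cases hy : pick G τ (runA G τ ∅ pre) u with
  | none =>
    simp only [hy] at one
    have h1 := hid (m - 1) (by omega)
    have h2 : m - 1 + 1 = m := by omega
    rw [h2, ham] at h1
    have : ∑ k ∈ Finset.range m, a k ≤ ∑ k ∈ Finset.range m,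
        (gainV G a (τ.take k ++ v :: τ.drop k) (pre ++ u :: post) v
         + gainU G a (τ.take k ++ v :: τ.drop k) u ∅ (pre ++ u :: post)) := by
      apply Finset.sum_le_sum
      intro k hk
      have hk := Finset.mem_range.1 hk
      have e := one k hk
      rw [hlk k hk] at e
      have := hU0 k hk
      linarith
    linarith
  | some y =>
    simp only [hy] at one
    set p := τ.idxOf y with hp
    have hpl : p < τ.length := List.idxOf_lt_length_of_mem (pick_some hy).1
    have h1 := hid p (by omega)
    have : ∑ k ∈ Finset.range m, (if k < p + 1 then a k + (1 - a (p + 1)) else 1 - a p)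
        ≤ ∑ k ∈ Finset.range m,
        (gainV G a (τ.take k ++ v :: τ.drop k) (pre ++ u :: post) v
         + gainU G a (τ.take k ++ v :: τ.drop k) u ∅ (pre ++ u :: post)) := by
      apply Finset.sum_le_sum
      intro k hk
      have hk := Finset.mem_range.1 hk
      have e := one k hk
      rw [hlk k hk] at e
      split_ifs with hkp
      · obtain ⟨e1, e2⟩ := e.1 (by omega)
        linarith
      · have := e.2 (by omega)
        have := hV0 (τ.take k ++ v :: τ.drop k)
        linarith
    refine le_trans (le_of_eq ?_) this
    obtain ⟨q, hq⟩ : ∃ q, m = (p + 1) + q := ⟨m - (p + 1), by omega⟩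
    have hqr : (m : ℝ) = ((p + 1 : ℕ) : ℝ) + q := by exact_mod_cast hq
    conv_rhs => rw [hq, Finset.sum_range_add]
    have s1 : ∑ k ∈ Finset.range (p + 1), (if k < p + 1 then a k + (1 - a (p + 1)) else 1 - a p)
        = ∑ k ∈ Finset.range (p + 1), a k + ((p + 1 : ℕ) : ℝ) * (1 - a (p + 1)) := by
      rw [Finset.sum_congr rfl (fun k hk => if_pos (Finset.mem_range.1 hk)),
        Finset.sum_add_distrib, Finset.sum_const, Finset.card_range, nsmul_eq_mul]
    have s2 : ∑ k ∈ Finset.range q, (if p + 1 + k < p + 1 then a (p + 1 + k) + (1 - a (p + 1))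
        else 1 - a p) = q * (1 - a p) := by
      rw [Finset.sum_congr rfl (fun k hk => if_neg (by omega)),
        Finset.sum_const, Finset.card_range, nsmul_eq_mul]
    rw [s1, s2]
    have hq2 : (q : ℝ) = m - ((p + 1 : ℕ) : ℝ) := by linarith
    rw [hq2]
    linarith

/-- per edge bound -/
theorem edge_bound (G : Finset (Finset V)) (a : ℕ → ℝ) (l : List V) (hl : l.Nodup) (u v : V)
    (hv : v ∈ l) (hG : ({u, v} : Finset V) ∈ G)
    (hmono : ∀ i j, i ≤ j → j ≤ l.length → a i ≤ a j) (ha0 : ∀ i, 0 ≤ a i) (ham : a l.length = 1)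
    (hid : ∀ p, p + 1 ≤ l.length → ((p + 1 : ℕ) : ℝ) * a (p + 1)
      + ((l.length : ℝ) - ((p + 1 : ℕ) : ℝ)) * a p
      = l.length * (Real.exp 1)⁻¹ + ∑ k ∈ Finset.range (p + 1), a k)
    (ω : List V) (hω : ω.Nodup) (hu : u ∈ ω) :
    (l.permutations.length : ℝ) * (1 - (Real.exp 1)⁻¹) ≤
      (l.permutations.map (fun σ => gainV G a σ ω v + gainU G a σ u ∅ ω)).sum := by
  have hperm : l.Perm (v :: l.erase v) := List.perm_cons_erase hv
  have hpp : l.permutations.Perm ((l.erase v).permutations'.flatMap (List.permutations'Aux v)) :=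
    (List.permutations_perm_permutations' l).trans hperm.permutations'
  rw [hpp.length_eq, (hpp.map _).sum_eq]
  have hvl : v ∉ l.erase v := hl.not_mem_erase
  have hmem : ∀ τ ∈ (l.erase v).permutations', v ∉ τ ∧ l.length = τ.length + 1 := by
    intro τ hτ
    have h := List.mem_permutations'.1 hτ
    refine ⟨fun hh => hvl (h.mem_iff.1 hh), ?_⟩
    rw [h.length_eq, hperm.length_eq]; simp
  generalize (l.erase v).permutations' = P at hmem
  induction P with
  | nil => simp
  | cons τ P ih =>
    have ih' := ih (fun x hx => hmem x (by simp [hx]))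
    obtain ⟨h1, h2⟩ := hmem τ (by simp)
    have h3 := gain_sum G a τ u v l.length h2 h1 hG hmono ha0 ham hid ω hω hu
    rw [List.flatMap_cons, List.map_append, List.sum_append, List.length_append,
      List.length_permutations'Aux, ← h2]
    push_cast
    linarith

end RankingAux

/-- **RANKING is (1 − 1/e)-competitive in expectation.** For a bipartite graph `G` with
offline part listed by `l` (ranked by a uniformly random permutation `σ` of `l`) and
online part `R` arriving in an arbitrary fixed order `ω`, if the maximum matching of `G`
has size `n`, then the expected size of the matching produced by RANKING is at least
`(1 − 1/e)·n`. -/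
theorem ranking_competitive
    {V : Type*} [DecidableEq V]
    (G : Finset (Finset V)) (hG : IsGraph G)
    (L R : Finset V) (hLR : Disjoint L R)
    (hbip : ∀ e ∈ G, ∃ u ∈ L, ∃ v ∈ R, e = {u, v})
    (l : List V) (hl : l.Nodup) (hlL : l.toFinset = L)
    (ω : List V) (hω : ω.Nodup) (hωR : ω.toFinset = R)
    (n : ℕ)
    (hmax : ∃ Mstar : Finset (Finset V), Mstar ⊆ G ∧ IsMatching Mstar ∧
      Mstar.card = n ∧
      ∀ N : Finset (Finset V), N ⊆ G → IsMatching N → N.card ≤ n) :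
    (1 - (Real.exp 1)⁻¹) * n ≤
      ((l.permutations.map (fun σ => ((ranking G σ ω).card : ℝ))).sum) /
        l.permutations.length := by
  obtain ⟨M, hMG, hMm, hMn, -⟩ := hmax
  obtain ⟨a, hmono, ha0, ham, hid⟩ := exists_weights l.length
  have hP0 : (0 : ℝ) < l.permutations.length := by
    rw [List.length_permutations]; exact_mod_cast Nat.factorial_pos _
  rw [le_div_iff₀ hP0]
  rcases isEmpty_or_nonempty V with hV | hV
  · have hM0 : M = ∅ := by
      apply Finset.eq_empty_of_forall_notMem
      intro e he
      obtain ⟨x, -⟩ := hbip e (hMG he)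
      exact hV.elim x
    have hn : n = 0 := by rw [← hMn, hM0]; rfl
    rw [hn]
    simp only [Nat.cast_zero, mul_zero, zero_mul]
    apply List.sum_nonneg
    intro x hx
    obtain ⟨σ, -, rfl⟩ := List.mem_map.1 hx
    positivity
  choose! fv hfv fu hfu he using hbip
  have hinjv : Set.InjOn fv M := by
    intro e hem f hfm hef
    by_contra hne
    have := hMm e hem f hfm hne
    rw [he e (hMG hem), he f (hMG hfm), hef] at this
    simp at this
  have hinju : Set.InjOn fu M := by
    intro e hem f hfm hef
    by_contra hne
    have := hMm e hem f hfm hne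
    rw [he e (hMG hem), he f (hMG hfm), hef] at this
    simp at this
  have hσ : ∀ σ ∈ l.permutations,
      ∑ e ∈ M, (gainV G a σ ω (fv e) + gainU G a σ (fu e) ∅ ω) ≤ ((ranking G σ ω).card : ℝ) := by
    intro σ hσ
    have hp := List.mem_permutations.1 hσ
    have hσL : σ.toFinset = L := by rw [← hlL]; exact List.toFinset_eq_of_perm _ _ hp
    have hc : (ranking G σ ω).card = (runA G σ ∅ ω).card :=
      ranking_card G L R hLR σ (fun x hx => by rw [← hσL]; simpa using hx) ω
        (fun x hx => by rw [← hωR]; simpa using hx) ∅ ∅ (by simp) rfl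
    rw [hc, ← sum_gain G a σ ω hω, Finset.sum_add_distrib, add_comm, hσL, hωR]
    apply add_le_add
    · rw [← Finset.sum_image (f := fun u => gainU G a σ u ∅ ω) hinju]
      apply Finset.sum_le_sum_of_subset_of_nonneg
      · intro x hx
        obtain ⟨e, hem, rfl⟩ := Finset.mem_image.1 hx
        exact hfu e (hMG hem)
      · intro x _ _
        apply gainU_nonneg
        intro i hi
        rw [← ham]
        exact hmono _ _ (by rw [← hp.length_eq]; omega) le_rfl
    · rw [← Finset.sum_image (f := fun v => gainV G a σ ω v) hinjv]
      apply Finset.sum_le_sum_of_subset_of_nonneg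
      · intro x hx
        obtain ⟨e, hem, rfl⟩ := Finset.mem_image.1 hx
        exact hfv e (hMG hem)
      · intro x _ _
        unfold gainV
        split_ifs
        · exact ha0 _
        · exact le_rfl
  refine le_trans ?_ (List.sum_le_sum hσ)
  have hsw : (l.permutations.map (fun σ =>
      ∑ e ∈ M, (gainV G a σ ω (fv e) + gainU G a σ (fu e) ∅ ω))).sum
      = ∑ e ∈ M, (l.permutations.map (fun σ =>
        (gainV G a σ ω (fv e) + gainU G a σ (fu e) ∅ ω))).sum := by
    generalize l.permutations = P
    induction P with
    | nil => simp
    | cons x xs ih => 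
      rw [List.map_cons, List.sum_cons, ih, ← Finset.sum_add_distrib]
      simp only [List.map_cons, List.sum_cons]
  rw [hsw]
  have : ∑ e ∈ M, (l.permutations.length : ℝ) * (1 - (Real.exp 1)⁻¹) ≤
      ∑ e ∈ M, (l.permutations.map (fun σ =>
        (gainV G a σ ω (fv e) + gainU G a σ (fu e) ∅ ω))).sum := by
    apply Finset.sum_le_sum
    intro e hem
    apply edge_bound G a l hl (fu e) (fv e) _ _ hmono ha0 ham hid ω hω
    · have := hfu e (hMG hem); rw [← hωR] at this; simpa using this
    · have := hfv e (hMG hem); rw [← hlL] at this; simpa using this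
    · rw [Finset.pair_comm, ← he e (hMG hem)]; exact hMG hem
  rw [Finset.sum_const, nsmul_eq_mul, hMn] at this
  linarith
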